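/- arXiv:2411.04680 — 5 statements merged into one kernel-verified Lean document; each statement's English description precedes it below -/
import Mathlib

section
/- Let M be a mechanism mapping datasets over X × Y to probability distributions over pairs (θ, O), where θ ranges over a parameter space Θ and O over finite subsets of Y. Suppose that for every dataset D, the second component of the output of M(D) almost surely equals labels(D) (or, more generally, almost surely equals the union of labels(D) with a fixed set). If there exists a dataset D and a record (x*, y*) with y* ∉ labels(D), then for every ε ≥ 0 and every δ with 0 ≤ δ < 1, M is not (ε, δ)-DP. -/
open scoped ENNReal

/-- Two datasets (multisets of records) are adjacent if one is obtained from
the other by adding a single record. -/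
def Adjacent {α : Type*} (D D' : Multiset α) : Prop :=
  (∃ r, D' = r ::ₘ D) ∨ (∃ r, D = r ::ₘ D')

/-- `(ε, δ)`-differential privacy for a mechanism from datasets to PMFs:
for all adjacent datasets and every set `S` of outcomes,
`Pr[M(D) ∈ S] ≤ exp ε * Pr[M(D') ∈ S] + δ`. -/
def IsDP {α Ω : Type*} (M : Multiset α → PMF Ω) (ε δ : ℝ) : Prop :=
  ∀ D D' : Multiset α, Adjacent D D' → ∀ S : Set Ω,
    (M D).toOuterMeasure S ≤
      ENNReal.ofReal (Real.exp ε) * (M D').toOuterMeasure S + ENNReal.ofReal δ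

/-- The finite set of labels occurring in a dataset. -/
def labelsOf {X Y : Type*} [DecidableEq Y] (D : Multiset (X × Y)) : Finset Y :=
  (D.map Prod.snd).toFinset

/-- Releasing the true label set (as the second component of the classifier)
is not `(ε, δ)`-DP for any `δ < 1`, as soon as some record with a fresh label
can be added to some dataset. -/
theorem not_dp_of_releases_label_space {X Y Θ : Type*} [Countable Y] [DecidableEq Y]
    (M : Multiset (X × Y) → PMF (Θ × Finset Y))
    (hM : ∀ D : Multiset (X × Y),
      (M D).toOuterMeasure {p : Θ × Finset Y | p.2 = labelsOf D} = 1)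
    (D : Multiset (X × Y)) (x : X) (y : Y) (hy : y ∉ labelsOf D) :
    ∀ ε : ℝ, 0 ≤ ε → ∀ δ : ℝ, 0 ≤ δ → δ < 1 → ¬ IsDP M ε δ := by
  intro ε _ δ _ hδ hdp
  have hlabels : labelsOf ((x, y) ::ₘ D) ≠ labelsOf D := by
    intro h
    exact hy (h ▸ by simp [labelsOf])
  have hzero : (M D).toOuterMeasure {p | p.2 = labelsOf ((x, y) ::ₘ D)} = 0 := by
    rw [PMF.toOuterMeasure_apply_eq_zero_iff, Set.disjoint_left]
    intro p hp hp'
    have hsupport := (PMF.toOuterMeasure_apply_eq_one_iff _ _).1 (hM D) hp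
    exact hlabels (hp'.symm.trans hsupport)
  have hle := hdp ((x, y) ::ₘ D) D (Or.inr ⟨(x, y), rfl⟩)
    {p | p.2 = labelsOf ((x, y) ::ₘ D)}
  rw [hM, hzero, mul_zero, zero_add] at hle
  exact absurd hle (not_le.2 (ENNReal.ofReal_lt_one.2 hδ))
end

section
/- Lower bound on the probability of dropping a small class: let L be an (ε, δ)-DP mechanism mapping datasets to probability distributions over finite subsets of Y, such that for every dataset E, L(E) ⊆ labels(E) almost surely. Let D be a dataset containing exactly k ≥ 1 records whose label equals y, and let D' be D with those k records removed. Then Pr[y ∈ L(D)] ≤ δ_k and hence Pr[y ∉ L(D)] ≥ 1 − δ_k, where δ_k = (∑_{i=0}^{k−1} exp(i·ε))·δ. -/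
open scoped ENNReal

/-- Group privacy: adding `s` to a dataset degrades the privacy guarantee geometrically in the
number of records of `s`. -/
theorem IsDP.add_le {α Ω : Type*} {M : Multiset α → PMF Ω} {ε δ : ℝ} (hδ : 0 ≤ δ)
    (hM : IsDP M ε δ) (D s : Multiset α) (S : Set Ω) :
    (M (s + D)).toOuterMeasure S ≤
      ENNReal.ofReal (Real.exp (Multiset.card s * ε)) * (M D).toOuterMeasure S +
        ENNReal.ofReal ((∑ i ∈ Finset.range (Multiset.card s), Real.exp ((i : ℝ) * ε)) * δ) := by
  induction s using Multiset.induction_on with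
  | empty => simp
  | cons r s ih =>
    have hexp (n : ℕ) : Real.exp (((n + 1 : ℕ) : ℝ) * ε) = Real.exp ε * Real.exp (n * ε) := by
      rw [← Real.exp_add]
      push_cast
      ring_nf
    have hsum : (∑ i ∈ Finset.range (Multiset.card s + 1), Real.exp ((i : ℝ) * ε)) * δ =
        Real.exp ε * ((∑ i ∈ Finset.range (Multiset.card s), Real.exp ((i : ℝ) * ε)) * δ) + δ := by
      rw [Finset.sum_range_succ', Finset.sum_congr rfl fun i _ => hexp i, ← Finset.mul_sum]
      simp
      ring
    calc
      _ ≤ ENNReal.ofReal (Real.exp ε) * (M (s + D)).toOuterMeasure S + ENNReal.ofReal δ :=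
        hM _ _ (Or.inr ⟨r, Multiset.cons_add r s D⟩) S
      _ ≤ _ := by
        grw [ih]
        rw [Multiset.card_cons, hsum, hexp, ENNReal.ofReal_add (by positivity) hδ,
          ENNReal.ofReal_mul (Real.exp_nonneg _), ENNReal.ofReal_mul (Real.exp_nonneg _),
          mul_add, mul_assoc, add_assoc]

/-- Lower bound on dropping a small class: if `L` is `(ε, δ)`-DP and almost
surely outputs a subset of the labels of its input, and `D` contains exactly
`k ≥ 1` records with label `y`, then `Pr[y ∈ L(D)] ≤ δ_k` and hence
`Pr[y ∉ L(D)] ≥ 1 − δ_k`, where `δ_k = (∑_{i<k} exp(i·ε))·δ`. -/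
theorem small_class_is_dropped {X Y : Type*} [Countable Y] [DecidableEq Y]
    (L : Multiset (X × Y) → PMF (Finset Y)) (ε δ : ℝ)
    (hε : 0 ≤ ε) (hδ0 : 0 ≤ δ) (hδ1 : δ ≤ 1)
    (hL : IsDP L ε δ)
    (hsub : ∀ E : Multiset (X × Y),
      (L E).toOuterMeasure {O : Finset Y | O ⊆ labelsOf E} = 1)
    (D : Multiset (X × Y)) (y : Y) (k : ℕ) (hk : 1 ≤ k)
    (hcount : Multiset.card (D.filter (fun r => r.2 = y)) = k) :
    (L D).toOuterMeasure {O : Finset Y | y ∈ O} ≤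
        ENNReal.ofReal ((∑ i ∈ Finset.range k, Real.exp ((i : ℝ) * ε)) * δ) ∧
      1 - ENNReal.ofReal ((∑ i ∈ Finset.range k, Real.exp ((i : ℝ) * ε)) * δ) ≤
        (L D).toOuterMeasure {O : Finset Y | y ∉ O} := by
  have hzero : (L (D.filter (fun r => ¬ r.2 = y))).toOuterMeasure {O : Finset Y | y ∈ O} = 0 := by
    rw [PMF.toOuterMeasure_apply_eq_zero_iff, Set.disjoint_left]
    intro O hO hy
    have hmem := (PMF.toOuterMeasure_apply_eq_one_iff _ _).1 (hsub _) hO hy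
    simp [labelsOf] at hmem
  have hle : (L D).toOuterMeasure {O : Finset Y | y ∈ O} ≤
      ENNReal.ofReal ((∑ i ∈ Finset.range k, Real.exp ((i : ℝ) * ε)) * δ) := by
    have h := hL.add_le hδ0 (D.filter (fun r => ¬ r.2 = y)) (D.filter (fun r => r.2 = y))
      {O : Finset Y | y ∈ O}
    rwa [hzero, mul_zero, zero_add, Multiset.filter_add_not, hcount] at h
  refine ⟨hle, tsub_le_iff_left.2 ?_⟩
  have hone : (L D).toOuterMeasure ({O : Finset Y | y ∈ O} ∪ {O : Finset Y | y ∉ O}) = 1 := by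
    rw [PMF.toOuterMeasure_apply_eq_one_iff]
    exact fun O _ => em (y ∈ O)
  rw [← hone]
  exact (MeasureTheory.measure_union_le _ _).trans (by gcongr)
end

section
/- Relation between label-release probabilities on adjacent datasets differing in a fresh label: let B be a mechanism from datasets to distributions over Bool, let L_B be the associated label-release mechanism (sample b_y ∼ B(D_y) independently for y ∈ labels(D) and output {y : b_y = true}). Let D be a dataset, (x*, y*) a record with y* ∉ labels(D), and D' = D with (x*, y*) added, so D'_{y*} = {(x*, y*)} and D'_y = D_y for all y ≠ y*. Then for every collection S of subsets of labels(D) (none of which contains y*), Pr[L_B(D') ∈ S] = Pr[B({(x*, y*)}) = false] · Pr[L_B(D) ∈ S]. -/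
open scoped ENNReal

/-- The sub-multiset `D_y` of records of `D` whose label equals `y`. -/
def classData {X Y : Type*} [DecidableEq Y] (D : Multiset (X × Y)) (y : Y) :
    Multiset (X × Y) :=
  D.filter (fun r => r.2 = y)

/-- Auxiliary: sample `b_y ~ B (D_y)` independently for each `y` in the list,
keeping the labels for which `true` was sampled. -/
noncomputable def releaseAux {X Y : Type*} [DecidableEq Y]
    (B : Multiset (X × Y) → PMF Bool) (D : Multiset (X × Y)) :
    List Y → PMF (Finset Y)
  | [] => PMF.pure ∅
  | y :: ys => (B (classData D y)).bind fun b =>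
      (releaseAux B D ys).map fun O => if b then insert y O else O

/-- The label-release mechanism `L_B` associated to a Boolean mechanism `B`:
output `{y ∈ labels(D) : b_y = true}` where the `b_y ~ B(D_y)` are sampled
independently for the distinct labels `y` of `D`. -/
noncomputable def labelRelease {X Y : Type*} [DecidableEq Y]
    (B : Multiset (X × Y) → PMF Bool) (D : Multiset (X × Y)) : PMF (Finset Y) :=
  releaseAux B D (labelsOf D).toList

/-- The distribution of the released labels does not depend on the order in which the labels
are processed. -/
theorem releaseAux_perm {X Y : Type*} [DecidableEq Y] (B : Multiset (X × Y) → PMF Bool)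
    (D : Multiset (X × Y)) {l₁ l₂ : List Y} (h : l₁.Perm l₂) :
    releaseAux B D l₁ = releaseAux B D l₂ := by
  induction h with
  | nil => rfl
  | cons a _ ih => simp only [releaseAux, ih]
  | swap a b l =>
    simp only [releaseAux, PMF.map_bind, PMF.map_comp]
    rw [PMF.bind_comm]
    congr 1
    funext c
    congr 1
    funext d
    congr 1
    funext O
    cases c <;> cases d <;> simp [Finset.insert_comm]
  | trans _ _ ih₁ ih₂ => exact ih₁.trans ih₂

/-- `releaseAux` depends on the dataset only through the classes of the processed labels. -/
theorem releaseAux_congr {X Y : Type*} [DecidableEq Y] (B : Multiset (X × Y) → PMF Bool)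
    {D D' : Multiset (X × Y)} {l : List Y} (h : ∀ z ∈ l, classData D z = classData D' z) :
    releaseAux B D l = releaseAux B D' l := by
  induction l with
  | nil => rfl
  | cons a l ih =>
    simp only [releaseAux, h a List.mem_cons_self,
      ih fun z hz => h z (List.mem_cons_of_mem a hz)]

/-- If no set in `S` contains `y`, then the event `S` forces the label `y` to be rejected. -/
theorem toOuterMeasure_releaseAux_cons {X Y : Type*} [DecidableEq Y]
    (B : Multiset (X × Y) → PMF Bool) (D : Multiset (X × Y)) (y : Y) (l : List Y)
    (S : Set (Finset Y)) (hS : ∀ O ∈ S, y ∉ O) :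
    (releaseAux B D (y :: l)).toOuterMeasure S =
      B (classData D y) false * (releaseAux B D l).toOuterMeasure S := by
  have hempty : (fun O => insert y O) ⁻¹' S = ∅ :=
    Set.eq_empty_of_forall_notMem fun O hO => hS _ hO (Finset.mem_insert_self y O)
  simp [releaseAux, PMF.toOuterMeasure_bind_apply, PMF.toOuterMeasure_map_apply,
    hempty]

theorem labelsOf_cons {X Y : Type*} [DecidableEq Y] (r : X × Y) (D : Multiset (X × Y)) :
    labelsOf (r ::ₘ D) = insert r.2 (labelsOf D) := by
  simp [labelsOf]

theorem classData_cons_of_ne {X Y : Type*} [DecidableEq Y] {r : X × Y} {z : Y} (h : r.2 ≠ z)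
    (D : Multiset (X × Y)) : classData (r ::ₘ D) z = classData D z :=
  Multiset.filter_cons_of_neg _ h

theorem classData_cons_self_of_notMem {X Y : Type*} [DecidableEq Y] {r : X × Y}
    {D : Multiset (X × Y)} (h : r.2 ∉ labelsOf D) : classData (r ::ₘ D) r.2 = {r} := by
  have hD : D.filter (fun s => s.2 = r.2) = 0 :=
    Multiset.filter_eq_nil.2 fun s hs hsr =>
      h (Multiset.mem_toFinset.2 (hsr ▸ Multiset.mem_map_of_mem Prod.snd hs))
  rw [classData, Multiset.filter_cons_of_pos (p := fun s => s.2 = r.2) D rfl, hD, Multiset.cons_zero]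

/-- Relation between label-release probabilities on adjacent datasets differing
in a record with a fresh label: for any collection `S` of subsets of
`labels(D)` (none of which contains the fresh label `y`),
`Pr[L_B(D') ∈ S] = Pr[B({(x, y)}) = false] · Pr[L_B(D) ∈ S]` where
`D' = D + {(x, y)}`. -/
theorem labelRelease_fresh_label_relation {X Y : Type*} [Countable Y] [DecidableEq Y]
    (B : Multiset (X × Y) → PMF Bool)
    (D : Multiset (X × Y)) (x : X) (y : Y) (hy : y ∉ labelsOf D)
    (S : Set (Finset Y)) (hS : ∀ O ∈ S, O ⊆ labelsOf D) :
    (labelRelease B ((x, y) ::ₘ D)).toOuterMeasure S =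
      (B {(x, y)}) false * (labelRelease B D).toOuterMeasure S := by
  have hperm : (labelsOf ((x, y) ::ₘ D)).toList.Perm (y :: (labelsOf D).toList) := by
    rw [labelsOf_cons]
    exact Finset.toList_insert hy
  have hcongr : releaseAux B ((x, y) ::ₘ D) (labelsOf D).toList =
      releaseAux B D (labelsOf D).toList :=
    releaseAux_congr B fun z hz =>
      classData_cons_of_ne (fun h : y = z => hy (h ▸ Finset.mem_toList.1 hz)) D
  rw [labelRelease, labelRelease, releaseAux_perm B _ hperm,
    toOuterMeasure_releaseAux_cons B _ y _ S fun O hO hyO => hy (hS O hO hyO),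
    classData_cons_self_of_notMem (r := (x, y)) hy, hcongr]
end

section
/- Necessary condition on δ for the label-release mechanism (first bound): let B be a mechanism from datasets to distributions over Bool and L_B the associated label-release mechanism (sample b_y ∼ B(D_y) independently for y ∈ labels(D) and output {y : b_y = true}). Let D be a dataset and (x*, y*) a record with y* ∉ labels(D), and D' = D with (x*, y*) added. If L_B is (ε, δ)-DP, then δ ≥ 1 − exp(ε)·Pr[B({(x*, y*)}) = false]. -/
open scoped ENNReal

theorem releaseAux_singleton_apply_empty {X Y : Type*} [DecidableEq Y]
    (B : Multiset (X × Y) → PMF Bool) (D : Multiset (X × Y)) (y : Y) :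
    releaseAux B D [y] ∅ = B (classData D y) false := by
  simp [releaseAux, PMF.bind_apply, PMF.pure_map]

theorem labelRelease_zero {X Y : Type*} [DecidableEq Y] (B : Multiset (X × Y) → PMF Bool) :
    labelRelease B 0 = PMF.pure ∅ := by
  simp [labelRelease, labelsOf, releaseAux]

theorem labelRelease_singleton_apply_empty {X Y : Type*} [DecidableEq Y]
    (B : Multiset (X × Y) → PMF Bool) (x : X) (y : Y) :
    labelRelease B {(x, y)} ∅ = B {(x, y)} false := by
  have hlabels : (labelsOf {(x, y)}).toList = [y] := by simp [labelsOf]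
  have hclass : classData {(x, y)} y = {(x, y)} := by simp [classData, Multiset.filter_singleton]
  rw [labelRelease, hlabels, releaseAux_singleton_apply_empty, hclass]

/-- Necessary condition on `δ` for the label-release mechanism (first bound):
if `L_B` is `(ε, δ)`-DP, then for any dataset `D` and record `(x, y)` whose
label is fresh for `D`, `δ ≥ 1 − exp ε · Pr[B({(x, y)}) = false]`. -/
theorem labelRelease_delta_lower_bound_one {X Y : Type*} [Countable Y] [DecidableEq Y]
    (B : Multiset (X × Y) → PMF Bool) (ε δ : ℝ)
    (hε : 0 ≤ ε) (hδ0 : 0 ≤ δ) (hδ1 : δ ≤ 1)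
    (hDP : IsDP (labelRelease B) ε δ)
    (D : Multiset (X × Y)) (x : X) (y : Y) (hy : y ∉ labelsOf D) :
    1 - Real.exp ε * ((B {(x, y)}) false).toReal ≤ δ := by
  -- The bound does not involve `D`, so it suffices to compare the datasets `0` and `{(x, y)}`.
  have h := hDP 0 {(x, y)} (Or.inl ⟨(x, y), rfl⟩) {∅}
  rw [PMF.toOuterMeasure_apply_singleton, PMF.toOuterMeasure_apply_singleton, labelRelease_zero,
    labelRelease_singleton_apply_empty, PMF.pure_apply, if_pos rfl] at h
  have hB : B {(x, y)} false ≠ ∞ := PMF.apply_ne_top _ _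
  have hreal := ENNReal.toReal_mono
    (ENNReal.add_ne_top.2 ⟨ENNReal.mul_ne_top ENNReal.ofReal_ne_top hB, ENNReal.ofReal_ne_top⟩) h
  rw [ENNReal.toReal_add (ENNReal.mul_ne_top ENNReal.ofReal_ne_top hB) ENNReal.ofReal_ne_top,
    ENNReal.toReal_mul, ENNReal.toReal_ofReal (Real.exp_pos ε).le, ENNReal.toReal_ofReal hδ0,
    ENNReal.toReal_one] at hreal
  linarith
end

section
/- Necessary condition on δ for the label-release mechanism (second bound): let B be a mechanism from datasets to distributions over Bool and L_B the associated label-release mechanism (sample b_y ∼ B(D_y) independently for y ∈ labels(D) and output {y : b_y = true}). Let D be a dataset and (x*, y*) a record with y* ∉ labels(D), and D' = D with (x*, y*) added. If L_B is (ε, δ)-DP, then δ ≥ Pr[L_B(D') ∈ S*], where S* = {O ⊆ labels(D') : y* ∈ O}; equivalently, δ ≥ Pr[B({(x*, y*)}) = true]. -/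
open scoped ENNReal

/-- Every output of `releaseAux` only contains labels from the given list. -/
lemma mem_of_mem_support_releaseAux {X Y : Type*} [DecidableEq Y]
    (B : Multiset (X × Y) → PMF Bool) (D : Multiset (X × Y)) {l : List Y} {O : Finset Y}
    (hO : O ∈ (releaseAux B D l).support) {y : Y} (hy : y ∈ O) : y ∈ l := by
  induction l generalizing O with
  | nil => simp_all [releaseAux]
  | cons z zs ih =>
    simp only [releaseAux, PMF.mem_support_bind_iff, PMF.mem_support_map_iff] at hO
    obtain ⟨b, -, O', hO', rfl⟩ := hO
    cases b <;> grind

/-- A label that does not occur in the dataset is never released. -/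
lemma labelRelease_toOuterMeasure_eq_zero {X Y : Type*} [DecidableEq Y]
    (B : Multiset (X × Y) → PMF Bool) {D : Multiset (X × Y)} {y : Y} (hy : y ∉ labelsOf D)
    {S : Set (Finset Y)} (hS : ∀ O ∈ S, y ∈ O) :
    (labelRelease B D).toOuterMeasure S = 0 := by
  rw [PMF.toOuterMeasure_apply_eq_zero_iff, Set.disjoint_left]
  intro O hO hOS
  exact hy (Finset.mem_toList.1 (mem_of_mem_support_releaseAux B D hO (hS O hOS)))

/-- On a single record, the label is released with the probability that `B` returns `true`. -/
lemma labelRelease_singleton_toOuterMeasure {X Y : Type*} [DecidableEq Y]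
    (B : Multiset (X × Y) → PMF Bool) (x : X) (y : Y) :
    (labelRelease B {(x, y)}).toOuterMeasure
        {O : Finset Y | O ⊆ labelsOf {(x, y)} ∧ y ∈ O} = B {(x, y)} true := by
  have hlabels : labelsOf {(x, y)} = {y} := by simp [labelsOf]
  have hclass : classData {(x, y)} y = {(x, y)} := by simp [classData]
  simp [labelRelease, hlabels, hclass, releaseAux, PMF.pure_map,
    PMF.toOuterMeasure_bind_apply, PMF.toOuterMeasure_pure_apply]

/-- Necessary condition on `δ` for the label-release mechanism (second bound):
if `L_B` is `(ε, δ)`-DP, then for any dataset `D` and record `(x, y)` whose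
label is fresh for `D` (with `D' = D + {(x, y)}`),
`δ ≥ Pr[L_B(D') ∈ S*]` where `S* = {O ⊆ labels(D') : y ∈ O}`; equivalently,
`δ ≥ Pr[B({(x, y)}) = true]`. -/
theorem labelRelease_delta_lower_bound_two {X Y : Type*} [Countable Y] [DecidableEq Y]
    (B : Multiset (X × Y) → PMF Bool) (ε δ : ℝ)
    (hε : 0 ≤ ε) (hδ0 : 0 ≤ δ) (hδ1 : δ ≤ 1)
    (hDP : IsDP (labelRelease B) ε δ)
    (D : Multiset (X × Y)) (x : X) (y : Y) (hy : y ∉ labelsOf D) :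
    (labelRelease B ((x, y) ::ₘ D)).toOuterMeasure
        {O : Finset Y | O ⊆ labelsOf ((x, y) ::ₘ D) ∧ y ∈ O} ≤
      ENNReal.ofReal δ ∧
    (B {(x, y)}) true ≤ ENNReal.ofReal δ := by
  have fresh_bound : ∀ D : Multiset (X × Y), y ∉ labelsOf D →
      (labelRelease B ((x, y) ::ₘ D)).toOuterMeasure
        {O : Finset Y | O ⊆ labelsOf ((x, y) ::ₘ D) ∧ y ∈ O} ≤ ENNReal.ofReal δ := by
    intro D hy
    have h := hDP ((x, y) ::ₘ D) D (Or.inr ⟨_, rfl⟩)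
      {O : Finset Y | O ⊆ labelsOf ((x, y) ::ₘ D) ∧ y ∈ O}
    rwa [labelRelease_toOuterMeasure_eq_zero B hy fun O hO => hO.2, mul_zero, zero_add] at h
  refine ⟨fresh_bound D hy, ?_⟩
  rw [← labelRelease_singleton_toOuterMeasure B x y]
  exact fresh_bound 0 (by simp [labelsOf])
end
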